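/- Let X be an ℝ^d-valued random variable with characteristic function φ. Assume E[‖X‖^p] < ∞ for all p > 0 and that for every β > 0, |φ(t)| = O(‖t‖^{−β}) as ‖t‖ → ∞. Then φ is a Schwartz function, and X admits a density that is a Schwartz function. -/

import Mathlib

open MeasureTheory
open scoped RealInnerProductSpace

/-- A function on `ℝ^d` is a Schwartz function: it is infinitely differentiable and it,
together with all its derivatives, decays faster than any polynomial. -/
def IsSchwartz {d : ℕ} {F : Type*} [NormedAddCommGroup F] [NormedSpace ℝ F]
    (f : EuclideanSpace ℝ (Fin d) → F) : Prop :=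
  ContDiff ℝ (⊤ : ℕ∞) f ∧
  ∀ k n : ℕ, ∃ C : ℝ, ∀ x, ‖x‖ ^ k * ‖iteratedFDeriv ℝ n f x‖ ≤ C

theorem interp_decay {E F : Type*} [NormedAddCommGroup E] [NormedSpace ℝ E]
    [NormedAddCommGroup F] [NormedSpace ℝ F] {g : E → F} (hg : Differentiable ℝ g) {M : ℝ}
    (hM : ∀ x y, ‖fderiv ℝ g y - fderiv ℝ g x‖ ≤ M * ‖y - x‖) (hM0 : 0 ≤ M)
    (hd : ∀ k : ℕ, ∃ C : ℝ, ∀ x, ‖x‖ ^ k * ‖g x‖ ≤ C) (k : ℕ) :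
    ∃ C : ℝ, ∀ x, ‖x‖ ^ k * ‖fderiv ℝ g x‖ ≤ C := by
  obtain ⟨A, hA⟩ := hd 0
  obtain ⟨B, hB⟩ := hd (2 * k)
  set C₁ : ℝ := 2 ^ (2 * k - 1) * (A + B) with hC₁
  have h1 : ∀ x, (1 + ‖x‖) ^ (2 * k) * ‖g x‖ ≤ C₁ := fun x => by
    have h := add_pow_le (zero_le_one) (norm_nonneg x) (2 * k)
    calc (1 + ‖x‖) ^ (2 * k) * ‖g x‖
        ≤ (2 ^ (2 * k - 1) * (1 ^ (2 * k) + ‖x‖ ^ (2 * k))) * ‖g x‖ := by gcongr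
      _ = 2 ^ (2 * k - 1) * (‖x‖ ^ 0 * ‖g x‖ + ‖x‖ ^ (2 * k) * ‖g x‖) := by
          rw [one_pow, pow_zero]; ring
      _ ≤ C₁ := by rw [hC₁]; gcongr; exacts [hA x, hB x]
  have hC0 : 0 ≤ C₁ := le_trans (by positivity) (h1 0)
  refine ⟨4 ^ k * C₁ + C₁ + M, fun x => ?_⟩
  set h : ℝ := ((1 + ‖x‖) ^ k)⁻¹ with hh
  have hpos : 0 < h := by positivity
  have hle : h ≤ 1 := inv_le_one_of_one_le₀ (one_le_pow₀ (by linarith [norm_nonneg x]))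
  have hsq : (1 + ‖x‖) ^ (2 * k) * h ^ 2 = 1 := by
    rw [hh, inv_pow, ← pow_mul, mul_comm k 2]; exact mul_inv_cancel₀ (by positivity)
  have key : ‖fderiv ℝ g x‖ ≤ (4 ^ k * C₁ + C₁ + M) * h := by
    refine ContinuousLinearMap.opNorm_le_of_unit_norm (by positivity) fun v hv => ?_
    set y := x + h • v with hy
    have hyx : y - x = h • v := by simp [hy]
    have hn : ‖y - x‖ = h := by rw [hyx, norm_smul, hv, mul_one, Real.norm_of_nonneg hpos.le]
    have hT : ‖g y - g x - fderiv ℝ g x (y - x)‖ ≤ (M * h) * ‖y - x‖ := by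
      refine (convex_closedBall x h).norm_image_sub_le_of_norm_fderiv_le'
        (𝕜 := ℝ) (fun z _ => hg z) (fun z hz => ?_) (Metric.mem_closedBall_self hpos.le) ?_
      · refine (hM x z).trans ?_
        gcongr
        simpa [dist_eq_norm] using hz
      · simp [dist_eq_norm, hn]
    rw [hn, hyx, map_smul] at hT
    have hxy : 1 + ‖x‖ ≤ 2 * (1 + ‖y‖) := by
      have : ‖x‖ ≤ ‖y‖ + ‖y - x‖ := by
        have := norm_sub_le y (y - x); simpa using this
      linarith [norm_nonneg y]
    have e1 : ‖g x‖ ≤ C₁ * h ^ 2 := by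
      calc ‖g x‖ = ((1 + ‖x‖) ^ (2 * k) * ‖g x‖) * h ^ 2 := by
            rw [mul_right_comm, hsq, one_mul]
        _ ≤ _ := by gcongr; exact h1 x
    have e2 : ‖g y‖ ≤ 4 ^ k * C₁ * h ^ 2 := by
      calc ‖g y‖ = ((1 + ‖x‖) ^ (2 * k) * ‖g y‖) * h ^ 2 := by
            rw [mul_right_comm, hsq, one_mul]
        _ ≤ ((2 * (1 + ‖y‖)) ^ (2 * k) * ‖g y‖) * h ^ 2 := by gcongr
        _ = 4 ^ k * ((1 + ‖y‖) ^ (2 * k) * ‖g y‖) * h ^ 2 := by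
            rw [mul_pow, pow_mul 2 2 k, show (2:ℝ) ^ 2 = 4 by norm_num]; ring
        _ ≤ _ := by gcongr; exact h1 y
    have e3 : ‖h • fderiv ℝ g x v‖ ≤ ‖g y‖ + ‖g x‖ + M * h * h := by
      have a1 := norm_sub_le (g y - g x) (g y - g x - h • fderiv ℝ g x v)
      have a2 := norm_sub_le (g y) (g x)
      rw [sub_sub_cancel] at a1
      linarith
    rw [norm_smul, Real.norm_of_nonneg hpos.le] at e3
    have : h * ‖fderiv ℝ g x v‖ ≤ h * ((4 ^ k * C₁ + C₁ + M) * h) := by nlinarith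
    exact le_of_mul_le_mul_left this hpos
  calc ‖x‖ ^ k * ‖fderiv ℝ g x‖ ≤ (1 + ‖x‖) ^ k * ((4 ^ k * C₁ + C₁ + M) * h) := by
        gcongr; linarith
    _ = 4 ^ k * C₁ + C₁ + M := by
        rw [hh]; field_simp

theorem decay_of_bounded {E F : Type*} [NormedAddCommGroup E] [NormedSpace ℝ E]
    [NormedAddCommGroup F] [NormedSpace ℝ F] {g : E → F} (hg : ContDiff ℝ (⊤ : ℕ∞) g)
    (hb : ∀ n : ℕ, ∃ C : ℝ, ∀ x, ‖iteratedFDeriv ℝ n g x‖ ≤ C)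
    (hd : ∀ k : ℕ, ∃ C : ℝ, ∀ x, ‖x‖ ^ k * ‖g x‖ ≤ C) (k n : ℕ) :
    ∃ C : ℝ, ∀ x, ‖x‖ ^ k * ‖iteratedFDeriv ℝ n g x‖ ≤ C := by
  have hdiff : ∀ n : ℕ, Differentiable ℝ (iteratedFDeriv ℝ n g) := fun n =>
    hg.differentiable_iteratedFDeriv (by exact_mod_cast ENat.natCast_lt_top n)
  induction n generalizing k with
  | zero => simpa using hd k
  | succ n ih =>
    obtain ⟨M, hM⟩ := hb (n + 2)
    have := interp_decay (hdiff n) (M := M) (fun x y => ?_) ((norm_nonneg _).trans (hM 0)) ih k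
    · simpa only [norm_fderiv_iteratedFDeriv] using this
    · have e := (continuousMultilinearCurryLeftEquiv ℝ (fun _ : Fin (n + 1) => E) F).dist_map
        (iteratedFDeriv ℝ (n + 1) g y) (iteratedFDeriv ℝ (n + 1) g x)
      rw [dist_eq_norm, dist_eq_norm] at e
      refine e.trans_le ?_
      exact convex_univ.norm_image_sub_le_of_norm_fderiv_le (𝕜 := ℝ)
        (fun z _ => hdiff (n + 1) z) (fun z _ => by
          rw [norm_fderiv_iteratedFDeriv]; exact hM z) (Set.mem_univ x) (Set.mem_univ y)

theorem nonneg_of_bump {d : ℕ} {F : EuclideanSpace ℝ (Fin d) → ℝ} (hF : Continuous F)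
    (h : ∀ (c : EuclideanSpace ℝ (Fin d)) (b : ContDiffBump c), 0 ≤ ∫ x, F x * b x) (c) :
    0 ≤ F c := by
  by_contra! hc
  have : ∀ᶠ x in nhds c, F x < F c / 2 :=
    hF.continuousAt.eventually_lt_const (by linarith)
  obtain ⟨r, hr, hr'⟩ := Metric.eventually_nhds_iff_ball.1 this
  let b : ContDiffBump c := ⟨r / 2, r, by positivity, by linarith⟩
  have hb := b.integral_pos (μ := volume)
  have h1 : ∫ x, F x * b x ≤ ∫ x, (F c / 2) * b x := by
    refine integral_mono ?_ (b.integrable.const_mul _) fun x => ?_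
    · exact (hF.mul b.continuous).integrable_of_hasCompactSupport b.hasCompactSupport.mul_left
    · by_cases hx : x ∈ Metric.ball c r
      · exact mul_le_mul_of_nonneg_right (hr' x hx).le b.nonneg
      · have : b x = 0 := b.zero_of_le_dist (by simpa using hx)
        simp [this]
  rw [integral_const_mul] at h1
  nlinarith [h c b]

open scoped SchwartzMap FourierTransform

theorem isSchwartz_coe {d : ℕ} {F : Type*} [NormedAddCommGroup F] [NormedSpace ℝ F]
    (s : 𝓢(EuclideanSpace ℝ (Fin d), F)) : IsSchwartz (fun x => s x) :=
  ⟨s.smooth ⊤, fun k n => s.decay' k n⟩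

/-- the (normalised) Fourier transform of a measure -/
noncomputable def measFourier {d : ℕ} (ν : Measure (EuclideanSpace ℝ (Fin d))) :
    EuclideanSpace ℝ (Fin d) → ℂ :=
  VectorFourier.fourierIntegral Real.fourierChar ν (innerₗ (EuclideanSpace ℝ (Fin d))) 1

theorem measFourier_schwartz {d : ℕ} (ν : Measure (EuclideanSpace ℝ (Fin d)))
    [IsProbabilityMeasure ν] (hmom : ∀ n : ℕ, Integrable (fun x => ‖x‖ ^ n) ν)
    (hd : ∀ k : ℕ, ∃ C : ℝ, ∀ x, ‖x‖ ^ k * ‖measFourier ν x‖ ≤ C) :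
    ∃ s : 𝓢(EuclideanSpace ℝ (Fin d), ℂ), ∀ x, s x = measFourier ν x := by
  have hf : ∀ n : ℕ, (n : ℕ∞) ≤ ⊤ → Integrable (fun v : EuclideanSpace ℝ (Fin d) =>
      ‖v‖ ^ n * ‖(1 : EuclideanSpace ℝ (Fin d) → ℂ) v‖) ν := fun n _ => by simpa using hmom n
  have hc : ContDiff ℝ (⊤ : ℕ∞) (measFourier ν) :=
    VectorFourier.contDiff_fourierIntegral (innerSL ℝ) hf
  have hb : ∀ n : ℕ, ∃ C : ℝ, ∀ x, ‖iteratedFDeriv ℝ n (measFourier ν) x‖ ≤ C := fun n => by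
    have : iteratedFDeriv ℝ n (measFourier ν) = _ :=
      VectorFourier.iteratedFDeriv_fourierIntegral (innerSL ℝ) hf
        (aestronglyMeasurable_const) le_top
    rw [this]
    refine ⟨∫ v, ‖VectorFourier.fourierPowSMulRight (innerSL ℝ)
      (1 : EuclideanSpace ℝ (Fin d) → ℂ) v n‖ ∂ν, fun x => ?_⟩
    exact VectorFourier.norm_fourierIntegral_le_integral_norm _ _ _ _ _
  exact ⟨⟨measFourier ν, hc, decay_of_bounded hc hb hd⟩, fun _ => rfl⟩

theorem density_of_schwartz {d : ℕ} (ν : Measure (EuclideanSpace ℝ (Fin d)))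
    [IsProbabilityMeasure ν] (s : 𝓢(EuclideanSpace ℝ (Fin d), ℂ))
    (hs : ∀ x, s x = measFourier ν x) :
    ∃ f : EuclideanSpace ℝ (Fin d) → ℝ, IsSchwartz f ∧ (∀ x, 0 ≤ f x) ∧
      ν = volume.withDensity (fun x => ENNReal.ofReal (f x)) := by
  set p : 𝓢(EuclideanSpace ℝ (Fin d), ℂ) := 𝓕⁻ s with hp
  have hpair : ∀ G : 𝓢(EuclideanSpace ℝ (Fin d), ℂ), ∫ x, p x * G x = ∫ x, G x ∂ν := fun G => by
    rw [hp, SchwartzMap.integral_fourierInv_mul_eq]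
    have := VectorFourier.integral_fourierIntegral_smul_eq_flip (μ := ν) (ν := volume)
      (L := innerₗ (EuclideanSpace ℝ (Fin d))) (f := 1) (g := fun x => (𝓕⁻ G) x)
      Real.continuous_fourierChar continuous_inner (integrable_const 1) (𝓕⁻ G).integrable
    have h2 : ∀ x, VectorFourier.fourierIntegral Real.fourierChar volume
        (innerₗ (EuclideanSpace ℝ (Fin d))).flip (fun x => (𝓕⁻ G) x) x = G x := fun x => by
      rw [flip_innerₗ]
      exact congrArg (fun q : 𝓢(EuclideanSpace ℝ (Fin d), ℂ) => q x)
        (FourierTransform.fourier_fourierInv_eq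
          (E := 𝓢(EuclideanSpace ℝ (Fin d), ℂ)) (F := 𝓢(EuclideanSpace ℝ (Fin d), ℂ)) G)
    simp only [h2, smul_eq_mul, Pi.one_apply, one_mul] at this
    rw [← this]
    simp only [hs]; rfl
  have hbump : ∀ (c : EuclideanSpace ℝ (Fin d)) (b : ContDiffBump c),
      ∫ x, p x * (b x : ℂ) = ((∫ x, b x ∂ν : ℝ) : ℂ) := fun c b => by
    have h₁ : HasCompactSupport (fun x => (b x : ℂ)) :=
      b.hasCompactSupport.comp_left (g := fun r : ℝ => (r : ℂ)) Complex.ofReal_zero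
    have h₂ : ContDiff ℝ (⊤ : ℕ∞) (fun x => (b x : ℂ)) :=
      Complex.ofRealCLM.contDiff.comp b.contDiff
    have := hpair (h₁.toSchwartzMap h₂)
    rw [← integral_complex_ofReal]
    exact this
  have hbInt : ∀ (c : EuclideanSpace ℝ (Fin d)) (b : ContDiffBump c),
      Integrable (fun x => p x * (b x : ℂ)) := fun c b => by
    refine Continuous.integrable_of_hasCompactSupport ?_ ?_
    · exact p.continuous.mul (Complex.continuous_ofReal.comp b.continuous)
    · exact HasCompactSupport.mul_left
        (b.hasCompactSupport.comp_left (g := fun r : ℝ => (r : ℂ)) Complex.ofReal_zero)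
  have hre : ∀ (c : EuclideanSpace ℝ (Fin d)) (b : ContDiffBump c),
      ∫ x, (p x).re * b x = ∫ x, b x ∂ν := fun c b => by
    have h := congrArg Complex.re (hbump c b)
    rw [Complex.ofReal_re] at h
    rw [← h]
    have := integral_re (hbInt c b)
    simpa using this
  have him : ∀ (c : EuclideanSpace ℝ (Fin d)) (b : ContDiffBump c),
      ∫ x, (p x).im * b x = 0 := fun c b => by
    have h := congrArg Complex.im (hbump c b)
    rw [Complex.ofReal_im] at h
    rw [← h]
    have := integral_im (hbInt c b)
    simpa using this
  have hre0 : ∀ x, 0 ≤ (p x).re := nonneg_of_bump (Complex.continuous_re.comp p.continuous)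
    fun c b => by
      have := hre c b
      exact (integral_nonneg (fun x => b.nonneg)).trans_eq this.symm
  have him0 : ∀ x, (p x).im = 0 := fun x => by
    have a1 := nonneg_of_bump (Complex.continuous_im.comp p.continuous)
      (fun c b => (him c b).symm.le) x
    have a2 := nonneg_of_bump (Complex.continuous_im.comp p.continuous).neg
      (fun c b => by
        have := him c b
        simp only [Pi.neg_apply, Function.comp_apply, neg_mul, integral_neg, this, neg_zero,
          le_refl]) x
    simp only [Pi.neg_apply, Function.comp_apply] at a1 a2
    linarith
  let q : 𝓢(EuclideanSpace ℝ (Fin d), ℝ) := SchwartzMap.postcompCLM Complex.reCLM p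
  have hq : ∀ x, q x = (p x).re := fun x => rfl
  have hq0 : ∀ x, 0 ≤ q x := fun x => hre0 x
  have hqp : ∀ x, p x = (q x : ℂ) := fun x => Complex.ext rfl (him0 x)
  refine ⟨fun x => q x, isSchwartz_coe q, hq0, ?_⟩
  have : IsFiniteMeasure ((volume : Measure (EuclideanSpace ℝ (Fin d))).withDensity
      (fun x => ENNReal.ofReal (q x))) := isFiniteMeasure_withDensity_ofReal q.integrable.2
  refine Measure.ext_of_charFun ?_
  ext t
  rw [charFun_eq_fourierIntegral', charFun_eq_fourierIntegral']
  set w := -(2 * Real.pi)⁻¹ • t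
  have h1 : measFourier ν w = (𝓕 p) w := by
    rw [← hs, hp, FourierTransform.fourier_fourierInv_eq]
  refine h1.trans ?_
  rw [SchwartzMap.fourier_coe]
  change VectorFourier.fourierIntegral _ _ _ _ _ = _
  unfold VectorFourier.fourierIntegral
  rw [integral_withDensity_eq_integral_toReal_smul (by fun_prop) (by simp)]
  refine integral_congr_ae (Filter.Eventually.of_forall fun x => ?_)
  simp only [ENNReal.toReal_ofReal (hq0 x), Pi.one_apply, hqp, Circle.smul_def, smul_eq_mul,
    mul_one, Complex.real_smul]
  ring

/-- If `X` has all moments finite and its characteristic function decays faster than any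
polynomial, then the characteristic function is a Schwartz function and `X` admits a
density which is a Schwartz function. -/
theorem schwartz_density_of_rapid_decay
    {Ω : Type*} [MeasurableSpace Ω] (μ : Measure Ω) [IsProbabilityMeasure μ]
    {d : ℕ} (X : Ω → EuclideanSpace ℝ (Fin d)) (hX : Measurable X)
    (hmom : ∀ p : ℝ, 0 < p → Integrable (fun ω => ‖X ω‖ ^ p) μ)
    (hdecay : ∀ β : ℝ, 0 < β → ∃ C : ℝ, ∀ t : EuclideanSpace ℝ (Fin d), 1 ≤ ‖t‖ →
      ‖∫ ω, Complex.exp ((⟪t, X ω⟫ : ℝ) * Complex.I) ∂μ‖ ≤ C * ‖t‖ ^ (-β)) :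
    IsSchwartz (fun t => ∫ ω, Complex.exp ((⟪t, X ω⟫ : ℝ) * Complex.I) ∂μ) ∧
    ∃ f : EuclideanSpace ℝ (Fin d) → ℝ, IsSchwartz f ∧ (∀ x, 0 ≤ f x) ∧
      μ.map X = volume.withDensity (fun x => ENNReal.ofReal (f x)) := by
  set ν := μ.map X with hν
  have : IsProbabilityMeasure ν := Measure.isProbabilityMeasure_map hX.aemeasurable
  set φ : EuclideanSpace ℝ (Fin d) → ℂ :=
    fun t => ∫ ω, Complex.exp ((⟪t, X ω⟫ : ℝ) * Complex.I) ∂μ with hφ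
  have hφc : ∀ t, φ t = charFun ν t := fun t => by
    rw [charFun_apply, hν, integral_map hX.aemeasurable (by fun_prop)]
    simp only [hφ, real_inner_comm]
  have hφm : ∀ t, φ t = measFourier ν (-(2 * Real.pi)⁻¹ • t) := fun t => by
    rw [hφc, charFun_eq_fourierIntegral']; rfl
  have hpi : 1 ≤ 2 * Real.pi := by linarith [Real.pi_gt_three]
  have hmφ : ∀ w, measFourier ν w = φ (-(2 * Real.pi) • w) := fun w => by
    rw [hφm, smul_smul]
    have : -(2 * Real.pi)⁻¹ * -(2 * Real.pi) = 1 := by field_simp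
    rw [this, one_smul]
  have hmom' : ∀ n : ℕ, Integrable (fun x => ‖x‖ ^ n) ν := fun n => by
    rcases Nat.eq_zero_or_pos n with rfl | hn
    · simp
    · rw [hν, integrable_map_measure (by fun_prop) hX.aemeasurable]
      simpa [Function.comp_def] using hmom n (by exact_mod_cast hn)
  have hd : ∀ k : ℕ, ∃ C : ℝ, ∀ x, ‖x‖ ^ k * ‖measFourier ν x‖ ≤ C := fun k => by
    have hle : ∀ t, ‖φ t‖ ≤ 1 := fun t => by rw [hφc]; exact norm_charFun_le_one t
    obtain ⟨C, hC⟩ := hdecay (k + 1) (by positivity)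
    refine ⟨max C 1, fun x => ?_⟩
    set t := -(2 * Real.pi) • x with ht
    have hxt : ‖x‖ ≤ ‖t‖ := by
      rw [ht, norm_smul, norm_neg, Real.norm_of_nonneg (by linarith)]
      nlinarith [norm_nonneg x]
    rw [hmφ]
    rcases le_total 1 ‖t‖ with h1 | h1
    · have h0 : 0 < ‖t‖ := by linarith
      have hb : ‖φ t‖ ≤ C * ‖t‖ ^ (-((k : ℝ) + 1)) := hC t h1
      rw [Real.rpow_neg h0.le, ← Nat.cast_succ, Real.rpow_natCast] at hb
      have hm : ‖φ t‖ * ‖t‖ ^ (k + 1) ≤ C := by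
        rw [← div_eq_mul_inv] at hb
        exact (le_div_iff₀ (by positivity)).1 hb
      calc ‖x‖ ^ k * ‖φ t‖ ≤ ‖t‖ ^ (k + 1) * ‖φ t‖ := by
            gcongr
            calc ‖x‖ ^ k ≤ ‖t‖ ^ k := by gcongr
              _ ≤ ‖t‖ ^ (k + 1) := pow_le_pow_right₀ h1 (by omega)
        _ ≤ C := by rw [mul_comm]; exact hm
        _ ≤ _ := le_max_left _ _
    · calc ‖x‖ ^ k * ‖φ t‖ ≤ 1 * 1 := by
            gcongr
            · exact pow_le_one₀ (norm_nonneg _) (hxt.trans h1)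
            · exact hle t
        _ ≤ _ := by simp
  obtain ⟨s, hs⟩ := measFourier_schwartz ν hmom' hd
  refine ⟨?_, density_of_schwartz ν s hs⟩
  have hu : -(2 * Real.pi)⁻¹ ≠ 0 := by simp [Real.pi_ne_zero]
  let e : EuclideanSpace ℝ (Fin d) ≃L[ℝ] EuclideanSpace ℝ (Fin d) :=
    ContinuousLinearEquiv.smulLeft (Units.mk0 _ hu)
  have : φ = fun t => SchwartzMap.compCLMOfContinuousLinearEquiv ℝ e s t := by
    ext t
    rw [hφm, ← hs]; rfl
  rw [this]
  exact isSchwartz_coe _
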